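/- arXiv:2302.14836 — 7 statements merged into one kernel-verified Lean document; each statement's English description precedes it below -/
import Mathlib

section
/- Let H be a real symmetric n × n matrix, let A be a real m × n matrix of full row rank m (m ≤ n), and let K = [[H, Aᵀ], [A, 0]] be the associated (n+m) × (n+m) KKT matrix. Let Z be a real n × (n−m) matrix whose columns form a basis of the nullspace of A. Then the inertia of K equals the inertia of the reduced Hessian ZᵀHZ plus (m, m, 0); that is, the number of positive eigenvalues of K (counted with multiplicity) equals the number of positive eigenvalues of ZᵀHZ plus m, the number of negative eigenvalues of K equals the number of negative eigenvalues of ZᵀHZ plus m, and the number of zero eigenvalues of K equals the number of zero eigenvalues of ZᵀHZ. -/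
open Matrix

lemma card_pos_add_card_neg_add_card_zero {ι : Type*} [Fintype ι] (w : ι → ℝ) :
    (Finset.univ.filter fun i => 0 < w i).card + (Finset.univ.filter fun i => w i < 0).card +
      (Finset.univ.filter fun i => w i = 0).card = Fintype.card ι := by
  simp only [Finset.card_filter, ← Finset.sum_add_distrib, Fintype.card_eq_sum_ones]
  refine Finset.sum_congr rfl fun i _ => ?_
  rcases lt_trichotomy (w i) 0 with h | h | h
  · simp [h, h.ne, h.not_gt]
  · simp [h]
  · simp [h, h.ne', h.not_gt]

namespace Matrix

lemma equivalent_weightedSumSquares_of_congr_diagonal {ι κ : Type*} [Fintype ι]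
    [DecidableEq ι] [Fintype κ] [DecidableEq κ] (hcard : Fintype.card κ = Fintype.card ι)
    {M : Matrix ι ι ℝ} {P : Matrix ι κ ℝ} {w : κ → ℝ}
    (hP : Function.Injective P.mulVec) (hMP : Pᵀ * M * P = diagonal w) :
    M.toQuadraticForm'.Equivalent (QuadraticMap.weightedSumSquares ℝ w) := by
  refine QuadraticMap.Equivalent.symm
    ⟨⟨P.mulVecLin.linearEquivOfInjective hP (by simpa using hcard), fun x => ?_⟩⟩
  change M.toQuadraticForm' (P *ᵥ x) = _
  have h : P *ᵥ x ⬝ᵥ M *ᵥ (P *ᵥ x) = x ⬝ᵥ (Pᵀ * M * P) *ᵥ x := by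
    simp [← mulVec_mulVec, dotProduct_mulVec, vecMul_transpose]
  have hq : M.toQuadraticForm' (P *ᵥ x) = P *ᵥ x ⬝ᵥ M *ᵥ (P *ᵥ x) := by
    simp [toQuadraticForm', toLinearMap₂'_apply']
  rw [hq, h, hMP, QuadraticMap.weightedSumSquares_apply]
  simp only [dotProduct, mulVec_diagonal, smul_eq_mul]
  exact Finset.sum_congr rfl fun i _ => by ring

namespace IsHermitian

lemma exists_congr_diagonal_eigenvalues {ι : Type*} [Fintype ι] [DecidableEq ι]
    {M : Matrix ι ι ℝ} (hM : M.IsHermitian) :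
    ∃ U : Matrix ι ι ℝ, Function.Injective U.mulVec ∧ Uᵀ * M * U = diagonal hM.eigenvalues := by
  have hU : (hM.eigenvectorUnitary : Matrix ι ι ℝ)ᵀ * hM.eigenvectorUnitary = 1 :=
    Unitary.coe_star_mul_self hM.eigenvectorUnitary
  refine ⟨hM.eigenvectorUnitary, Function.LeftInverse.injective (g := (_ᵀ).mulVec)
    fun x => by rw [mulVec_mulVec, hU, one_mulVec], ?_⟩
  have h := hM.conjStarAlgAut_star_eigenvectorUnitary
  rw [Unitary.conjStarAlgAut_star_apply] at h
  exact h

/-- **Sylvester's law of inertia** for a real symmetric matrix congruent to a diagonal one. -/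
lemma card_eigenvalues_of_congr_diagonal {ι κ : Type*} [Fintype ι]
    [DecidableEq ι] [Fintype κ] [DecidableEq κ] {M : Matrix ι ι ℝ} (hM : M.IsHermitian)
    (hcard : Fintype.card κ = Fintype.card ι) {P : Matrix ι κ ℝ} {w : κ → ℝ}
    (hP : Function.Injective P.mulVec) (hMP : Pᵀ * M * P = diagonal w) :
    (Finset.univ.filter fun i => 0 < hM.eigenvalues i).card
        = (Finset.univ.filter fun i => 0 < w i).card ∧
    (Finset.univ.filter fun i => hM.eigenvalues i < 0).card
        = (Finset.univ.filter fun i => w i < 0).card := by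
  obtain ⟨U, hU, hMU⟩ := hM.exists_congr_diagonal_eigenvalues
  have he := equivalent_weightedSumSquares_of_congr_diagonal rfl hU hMU
  have hw := equivalent_weightedSumSquares_of_congr_diagonal hcard hP hMP
  have hp := (QuadraticForm.sigPos_of_equiv_weightedSumSquares he).symm.trans
    (QuadraticForm.sigPos_of_equiv_weightedSumSquares hw)
  have hn := (QuadraticForm.sigNeg_of_equiv_weightedSumSquares he).symm.trans
    (QuadraticForm.sigNeg_of_equiv_weightedSumSquares hw)
  simp only [← Set.ncard_coe_finset, Finset.coe_filter, Finset.mem_univ, true_and]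
  exact ⟨hp, hn⟩

end IsHermitian

/-- A congruence that decouples the reduced Hessian in a KKT matrix from the constraints. -/
lemma transpose_mul_kkt_mul_eq_fromBlocks.{u, v, w} {ι : Type v} {μ : Type w} {κ ν : Type u}
    [Fintype ι] [Fintype κ] [Fintype μ] [Fintype ν] [DecidableEq μ]
    {H : Matrix ι ι ℝ} (hH : H.IsSymm) {A : Matrix μ ι ℝ} {Z : Matrix ι κ ℝ} {B : Matrix ι μ ℝ}
    (hAZ : A * Z = 0) (hAB : A * B = 1) (Y S : Matrix μ ν ℝ) :
    (fromBlocks Z (B * Y) (-(Bᵀ * H * Z)) (S - (1 / 2 : ℝ) • (Bᵀ * H * B * Y)))ᵀ *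
      fromBlocks H Aᵀ A 0 *
      fromBlocks Z (B * Y) (-(Bᵀ * H * Z)) (S - (1 / 2 : ℝ) • (Bᵀ * H * B * Y)) =
    fromBlocks (Zᵀ * H * Z) 0 0 (Yᵀ * S + Sᵀ * Y) := by
  have hZA : Zᵀ * Aᵀ = 0 := by rw [← transpose_mul, hAZ, transpose_zero]
  have hBA : Bᵀ * Aᵀ = 1 := by rw [← transpose_mul, hAB, transpose_one]
  have hAB' (X : Matrix μ ν ℝ) : A * (B * X) = X := by
    rw [← Matrix.mul_assoc, hAB, Matrix.one_mul]
  have hZA' {τ : Type u} (X : Matrix μ τ ℝ) : Zᵀ * (Aᵀ * X) = 0 := by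
    rw [← Matrix.mul_assoc, hZA, Matrix.zero_mul]
  have hBA' {τ : Type u} (X : Matrix μ τ ℝ) : Bᵀ * (Aᵀ * X) = X := by
    rw [← Matrix.mul_assoc, hBA, Matrix.one_mul]
  rw [Matrix.mul_assoc, fromBlocks_transpose, fromBlocks_multiply, fromBlocks_multiply,
    fromBlocks_inj]
  simp only [transpose_neg, transpose_sub, transpose_smul, transpose_mul, transpose_transpose,
    hH.eq, Matrix.mul_assoc, Matrix.mul_add, Matrix.mul_sub, Matrix.mul_neg,
    Matrix.sub_mul, Matrix.neg_mul, Matrix.smul_mul, Matrix.mul_smul, hAZ, hAB', hZA', hBA', Matrix.mul_zero,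
    Matrix.zero_mul]
  refine ⟨?_, ?_, ?_, ?_⟩ <;> module

end Matrix

/-- (Inertia of the KKT matrix.) For `H` real symmetric `n × n`,
`A` real `m × n` of full row rank `m`, `K = [[H, Aᵀ], [A, 0]]`, and `Z` an
`n × (n-m)` matrix whose columns form a basis of the nullspace of `A`,
the inertia of `K` equals the inertia of the reduced Hessian `ZᵀHZ` plus `(m, m, 0)`. -/
theorem statement3 (n m : ℕ) (hmn : m ≤ n)
    (H : Matrix (Fin n) (Fin n) ℝ) (hH : H.IsSymm)
    (A : Matrix (Fin m) (Fin n) ℝ) (hA : A.rank = m)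
    (Z : Matrix (Fin n) (Fin (n - m)) ℝ)
    (hZind : LinearIndependent ℝ (fun j : Fin (n - m) => fun i : Fin n => Z i j))
    (hZspan : Submodule.span ℝ
        (Set.range (fun j : Fin (n - m) => fun i : Fin n => Z i j)) =
      LinearMap.ker A.mulVecLin)
    (hK : (Matrix.fromBlocks H Aᵀ A 0).IsHermitian)
    (hR : (Zᵀ * H * Z).IsHermitian) :
    (Finset.univ.filter fun i => 0 < hK.eigenvalues i).card
        = (Finset.univ.filter fun i => 0 < hR.eigenvalues i).card + m ∧
    (Finset.univ.filter fun i => hK.eigenvalues i < 0).card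
        = (Finset.univ.filter fun i => hR.eigenvalues i < 0).card + m ∧
    (Finset.univ.filter fun i => hK.eigenvalues i = 0).card
        = (Finset.univ.filter fun i => hR.eigenvalues i = 0).card := by
  have hAZ : A * Z = 0 := by
    ext i j
    have : (fun i => Z i j) ∈ LinearMap.ker A.mulVecLin :=
      hZspan ▸ Submodule.subset_span ⟨j, rfl⟩
    exact congrFun (LinearMap.mem_ker.mp this) i
  obtain ⟨B, hAB⟩ : ∃ B : Matrix (Fin n) (Fin m) ℝ, A * B = 1 := by
    rw [← mulVec_surjective_iff_exists_right_inverse]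
    refine LinearMap.range_eq_top.mp
      (Submodule.eq_top_of_finrank_eq (S := LinearMap.range A.mulVecLin) ?_)
    simpa [Matrix.rank] using hA
  have hZ : Function.Injective Z.mulVec := mulVec_injective_iff.mpr hZind
  obtain ⟨U, hU, hD⟩ := hR.exists_congr_diagonal_eigenvalues
  have hAZU : A * (Z * U) = 0 := by rw [← Matrix.mul_assoc, hAZ, Matrix.zero_mul]
  have hZU : Function.Injective (Z * U).mulVec := by
    intro x y hxy
    simp only [← mulVec_mulVec] at hxy
    exact hU (hZ hxy)
  let Y : Matrix (Fin m) (Fin m ⊕ Fin m) ℝ := fromCols 1 1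
  let S : Matrix (Fin m) (Fin m ⊕ Fin m) ℝ := fromCols ((1 / 2 : ℝ) • 1) (-(1 / 2 : ℝ) • 1)
  have hYS : Yᵀ * S + Sᵀ * Y = diagonal (Sum.elim (fun _ => 1) fun _ => -1) := by
    simp only [Y, S, transpose_fromCols, fromRows_mul_fromCols, fromBlocks_add,
      ← fromBlocks_diagonal, fromBlocks_inj, ← smul_one_eq_diagonal, transpose_smul, transpose_one,
      Matrix.one_mul, Matrix.mul_one]
    refine ⟨?_, ?_, ?_, ?_⟩ <;> module
  obtain ⟨hp, hn⟩ := hK.card_eigenvalues_of_congr_diagonal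
    (w := Sum.elim hR.eigenvalues (Sum.elim (fun _ : Fin m => 1) fun _ : Fin m => -1))
    (by simp; omega)
    (P := fromBlocks (Z * U) (B * Y) (-(Bᵀ * H * (Z * U))) (S - (1 / 2 : ℝ) • (Bᵀ * H * B * Y)))
    (by
      refine (injective_iff_map_eq_zero (Matrix.mulVecLin _)).mpr fun x hx => ?_
      rw [mulVecLin_apply, fromBlocks_mulVec] at hx
      have h1 : (Z * U) *ᵥ (x ∘ Sum.inl) + (B * Y) *ᵥ (x ∘ Sum.inr) = 0 :=
        funext fun i => congrFun hx (Sum.inl i)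
      have h2 : (-(Bᵀ * H * (Z * U))) *ᵥ (x ∘ Sum.inl) +
          (S - (1 / 2 : ℝ) • (Bᵀ * H * B * Y)) *ᵥ (x ∘ Sum.inr) = 0 :=
        funext fun i => congrFun hx (Sum.inr i)
      have hy : Y *ᵥ (x ∘ Sum.inr) = 0 := by
        simpa [mulVec_add, mulVec_mulVec, hAZU, ← Matrix.mul_assoc, hAB] using
          congrArg A.mulVec h1
      have hl : x ∘ Sum.inl = 0 := hZU (by simpa [← mulVec_mulVec, hy] using h1)
      have hs : S *ᵥ (x ∘ Sum.inr) = 0 := by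
        simpa [sub_mulVec, smul_mulVec, ← mulVec_mulVec, hy, hl] using h2
      have hr (i : Fin m) : x (Sum.inr (Sum.inl i)) = 0 ∧ x (Sum.inr (Sum.inr i)) = 0 := by
        have h3 := congrFun hy i
        have h4 := congrFun hs i
        simp [Y, S, fromCols_mulVec, smul_mulVec, neg_mulVec] at h3 h4
        constructor <;> linarith
      funext i
      rcases i with i | i | i
      exacts [congrFun hl i, (hr i).1, (hr i).2])
    (by
      rw [transpose_mul_kkt_mul_eq_fromBlocks hH hAZU hAB, hYS,
        show (Z * U)ᵀ * H * (Z * U) = diagonal hR.eigenvalues by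
          rw [← hD]; simp only [transpose_mul, Matrix.mul_assoc],
        fromBlocks_diagonal])
  have hp' : (Finset.univ.filter fun i => 0 < hK.eigenvalues i).card
      = (Finset.univ.filter fun i => 0 < hR.eigenvalues i).card + m := by
    rw [hp]
    simp only [Finset.card_filter, Fintype.sum_sum_type]
    change (∑ i, if 0 < hR.eigenvalues i then 1 else 0) +
      ((∑ i : Fin m, if 0 < (1 : ℝ) then 1 else 0) +
        ∑ i : Fin m, if 0 < (-1 : ℝ) then 1 else 0) = _
    norm_num
  have hn' : (Finset.univ.filter fun i => hK.eigenvalues i < 0).card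
      = (Finset.univ.filter fun i => hR.eigenvalues i < 0).card + m := by
    rw [hn]
    simp only [Finset.card_filter, Fintype.sum_sum_type]
    change (∑ i, if hR.eigenvalues i < 0 then 1 else 0) +
      ((∑ i : Fin m, if (1 : ℝ) < 0 then 1 else 0) +
        ∑ i : Fin m, if (-1 : ℝ) < 0 then 1 else 0) = _
    norm_num
  have hKc := card_pos_add_card_neg_add_card_zero hK.eigenvalues
  have hRc := card_pos_add_card_neg_add_card_zero hR.eigenvalues
  simp only [Fintype.card_sum, Fintype.card_fin] at hKc hRc
  exact ⟨hp', hn', by omega⟩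
end

section
/- Let H be a real symmetric n × n matrix, let A be a real m × n matrix of full row rank m (m ≤ n), let K = [[H, Aᵀ], [A, 0]] be the associated KKT matrix, and let Z be a real n × (n−m) matrix whose columns form a basis of the nullspace of A. Then the reduced Hessian ZᵀHZ is positive definite if and only if the inertia of K is (n, m, 0); that is, if and only if K has exactly n positive eigenvalues, exactly m negative eigenvalues, and no zero eigenvalue (counted with multiplicity). -/
open Matrix

section Inertia

theorem Matrix.toQuadraticForm'_apply {ι : Type*} [Fintype ι] [DecidableEq ι] (M : Matrix ι ι ℝ)
    (v : ι → ℝ) : M.toQuadraticForm' v = v ⬝ᵥ M *ᵥ v :=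
  toLinearMap₂'_apply' M v v

variable {ι : Type*} [Fintype ι] [DecidableEq ι] {M : Matrix ι ι ℝ}

/-- The quadratic form of a symmetric matrix is equivalent to the sum of squares weighted by the
eigenvalues. -/
theorem Matrix.IsHermitian.equivalent_weightedSumSquares_eigenvalues (hM : M.IsHermitian) :
    QuadraticMap.Equivalent M.toQuadraticForm'
      (QuadraticMap.weightedSumSquares ℝ hM.eigenvalues) := by
  refine ⟨⟨UnitaryGroup.toLinearEquiv (star hM.eigenvectorUnitary), fun x => ?_⟩⟩
  have hspec := hM.spectral_theorem
  rw [Unitary.conjStarAlgAut_apply] at hspec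
  let U : Matrix ι ι ℝ := ↑hM.eigenvectorUnitary
  have hy : UnitaryGroup.toLinearEquiv (star hM.eigenvectorUnitary) x = Uᵀ *ᵥ x := rfl
  have hd : x ⬝ᵥ M *ᵥ x = (Uᵀ *ᵥ x) ⬝ᵥ diagonal hM.eigenvalues *ᵥ (Uᵀ *ᵥ x) := by
    have hM' : M = U * diagonal hM.eigenvalues * Uᵀ := hspec
    conv_lhs => rw [hM']
    rw [← mulVec_mulVec, ← mulVec_mulVec, dotProduct_mulVec, ← mulVec_transpose]
  rw [toQuadraticForm'_apply, hd]
  refine (QuadraticMap.weightedSumSquares_apply _ _).trans ?_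
  simp only [AddHom.toFun_eq_coe, LinearMap.coe_toAddHom, LinearEquiv.coe_coe, hy, dotProduct,
    mulVec_diagonal, smul_eq_mul]
  exact Finset.sum_congr rfl fun i _ => by ring

theorem Matrix.IsHermitian.card_pos_eigenvalues_add_finrank_le (hM : M.IsHermitian)
    {V : Submodule ℝ (ι → ℝ)} (hV : ∀ v ∈ V, v ⬝ᵥ M *ᵥ v ≤ 0) :
    (Finset.univ.filter fun i => 0 < hM.eigenvalues i).card + Module.finrank ℝ V ≤
      Fintype.card ι := by
  have h := QuadraticForm.sigPos_add_finrank_le_of_nonpos (Q := M.toQuadraticForm') (V := V)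
    fun v hv => by simpa [toQuadraticForm'_apply] using hV v hv
  rw [QuadraticForm.sigPos_of_equiv_weightedSumSquares
    hM.equivalent_weightedSumSquares_eigenvalues] at h
  simpa [← Set.ncard_coe_finset] using h

theorem Matrix.IsHermitian.card_neg_eigenvalues_add_finrank_le (hM : M.IsHermitian)
    {V : Submodule ℝ (ι → ℝ)} (hV : ∀ v ∈ V, 0 ≤ v ⬝ᵥ M *ᵥ v) :
    (Finset.univ.filter fun i => hM.eigenvalues i < 0).card + Module.finrank ℝ V ≤
      Fintype.card ι := by
  have h := QuadraticForm.sigPos_add_finrank_le_of_nonpos (Q := -M.toQuadraticForm') (V := V)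
    fun v hv => by simpa [toQuadraticForm'_apply] using hV v hv
  rw [sigPos_neg, QuadraticForm.sigNeg_of_equiv_weightedSumSquares
    hM.equivalent_weightedSumSquares_eigenvalues] at h
  simpa [← Set.ncard_coe_finset] using h

theorem Matrix.IsHermitian.eigenvalues_ne_zero_of_mulVec_injective (hM : M.IsHermitian)
    (h : ∀ v, M *ᵥ v = 0 → v = 0) (i : ι) : hM.eigenvalues i ≠ 0 := by
  intro hi
  have hv := hM.mulVec_eigenvectorBasis i
  rw [hi, zero_smul] at hv
  exact hM.eigenvectorBasis.toBasis.ne_zero i (by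
    ext j
    simpa using congrFun (h _ hv) j)

end Inertia

section KKT

variable {ι κ : Type*} [Fintype ι] [Fintype κ]

theorem finrank_add_card_le_finrank_comap_inl (U : Submodule ℝ (ι → ℝ)) :
    Module.finrank ℝ U + Fintype.card κ ≤
      Module.finrank ℝ (U.comap (LinearMap.funLeft ℝ ℝ (Sum.inl : ι → ι ⊕ κ))) := by
  let f := U.mkQ ∘ₗ LinearMap.funLeft ℝ ℝ (Sum.inl : ι → ι ⊕ κ)
  have hker : LinearMap.ker f = U.comap (LinearMap.funLeft ℝ ℝ (Sum.inl : ι → ι ⊕ κ)) := by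
    rw [LinearMap.ker_comp, Submodule.ker_mkQ]
  have h₁ := f.finrank_range_add_finrank_ker
  have h₂ := (LinearMap.range f).finrank_le
  have h₃ := U.finrank_quotient_add_finrank
  rw [hker] at h₁
  simp only [Module.finrank_fintype_fun_eq_card, Fintype.card_sum] at h₁ h₃
  omega

theorem dotProduct_fromBlocks_mulVec_of_mulVec_eq_zero (H : Matrix ι ι ℝ) (A : Matrix κ ι ℝ)
    {v : ι ⊕ κ → ℝ} (hv : A *ᵥ (v ∘ Sum.inl) = 0) :
    v ⬝ᵥ fromBlocks H Aᵀ A 0 *ᵥ v = (v ∘ Sum.inl) ⬝ᵥ H *ᵥ (v ∘ Sum.inl) := by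
  have hy : (v ∘ Sum.inl) ⬝ᵥ Aᵀ *ᵥ (v ∘ Sum.inr) = 0 := by
    rw [dotProduct_mulVec, vecMul_transpose, hv, zero_dotProduct]
  rw [fromBlocks_mulVec, ← Sum.elim_comp_inl_inr v, sumElim_dotProduct_sumElim]
  simp [dotProduct_add, hv, hy]

theorem eq_zero_of_fromBlocks_mulVec_eq_zero {H : Matrix ι ι ℝ} {A : Matrix κ ι ℝ}
    (hpos : ∀ x, A *ᵥ x = 0 → x ≠ 0 → 0 < x ⬝ᵥ H *ᵥ x) (hA : A.rank = Fintype.card κ)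
    {v : ι ⊕ κ → ℝ} (hv : fromBlocks H Aᵀ A 0 *ᵥ v = 0) : v = 0 := by
  have hAx : A *ᵥ (v ∘ Sum.inl) = 0 := by
    ext i
    simpa [fromBlocks_mulVec] using congrFun hv (Sum.inr i)
  have hx : v ∘ Sum.inl = 0 := by
    by_contra hne
    have h := hpos _ hAx hne
    rw [← dotProduct_fromBlocks_mulVec_of_mulVec_eq_zero H A hAx, hv, dotProduct_zero] at h
    exact h.false
  have hAy : Aᵀ *ᵥ (v ∘ Sum.inr) = 0 := by
    ext i
    simpa [fromBlocks_mulVec, hx] using congrFun hv (Sum.inl i)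
  have hker : LinearMap.ker Aᵀ.mulVecLin = ⊥ := by
    have h := Aᵀ.mulVecLin.finrank_range_add_finrank_ker
    have hr : Module.finrank ℝ (LinearMap.range Aᵀ.mulVecLin) = Fintype.card κ := by
      rw [← hA, ← rank_transpose A]
      rfl
    rw [hr, Module.finrank_fintype_fun_eq_card] at h
    exact Submodule.finrank_eq_zero.mp (by omega)
  have hy : v ∘ Sum.inr = 0 := LinearMap.ker_eq_bot'.mp hker _ hAy
  ext (i | i)
  · exact congrFun hx i
  · exact congrFun hy i

theorem posDef_transpose_mul_mul_iff {H : Matrix ι ι ℝ} (hH : H.IsSymm) {Z : Matrix ι κ ℝ}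
    (hZ : LinearIndependent ℝ Z.col) :
    (Zᵀ * H * Z).PosDef ↔
      ∀ x ∈ LinearMap.range Z.mulVecLin, x ≠ 0 → 0 < x ⬝ᵥ H *ᵥ x := by
  have hquad (w : κ → ℝ) : w ⬝ᵥ (Zᵀ * H * Z) *ᵥ w = (Z *ᵥ w) ⬝ᵥ H *ᵥ (Z *ᵥ w) := by
    rw [← mulVec_mulVec, ← mulVec_mulVec, dotProduct_mulVec, vecMul_transpose]
  have hsymm : (Zᵀ * H * Z).IsHermitian := by
    simp [IsHermitian, conjTranspose_eq_transpose_of_trivial, hH.eq, Matrix.mul_assoc]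
  rw [posDef_iff_dotProduct_mulVec]
  constructor
  · rintro ⟨-, h⟩ _ ⟨w, rfl⟩ hw
    have := h (x := w) (by rintro rfl; simp at hw)
    rwa [star_trivial, hquad] at this
  · refine fun h => ⟨hsymm, fun w hw => ?_⟩
    rw [star_trivial, hquad]
    refine h _ ⟨w, rfl⟩ fun h0 => hw ?_
    exact mulVec_injective_iff.mpr hZ (by simpa using h0)

end KKT

/-- The reduced Hessian `ZᵀHZ` is positive definite if and only if
the inertia of the KKT matrix `K = [[H, Aᵀ], [A, 0]]` is `(n, m, 0)`. -/
theorem statement4 (n m : ℕ) (hmn : m ≤ n)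
    (H : Matrix (Fin n) (Fin n) ℝ) (hH : H.IsSymm)
    (A : Matrix (Fin m) (Fin n) ℝ) (hA : A.rank = m)
    (Z : Matrix (Fin n) (Fin (n - m)) ℝ)
    (hZind : LinearIndependent ℝ (fun j : Fin (n - m) => fun i : Fin n => Z i j))
    (hZspan : Submodule.span ℝ
        (Set.range (fun j : Fin (n - m) => fun i : Fin n => Z i j)) =
      LinearMap.ker A.mulVecLin)
    (hK : (Matrix.fromBlocks H Aᵀ A 0).IsHermitian) :
    (Zᵀ * H * Z).PosDef ↔
      ((Finset.univ.filter fun i => 0 < hK.eigenvalues i).card = n ∧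
       (Finset.univ.filter fun i => hK.eigenvalues i < 0).card = m ∧
       (Finset.univ.filter fun i => hK.eigenvalues i = 0).card = 0) := by
  have hrange : LinearMap.range Z.mulVecLin = LinearMap.ker A.mulVecLin := by
    rw [range_mulVecLin, ← hZspan]
    rfl
  rw [posDef_transpose_mul_mul_iff hH hZind, hrange]
  simp only [LinearMap.mem_ker, mulVecLin_apply]
  constructor
  · intro hpos
    have hne := hK.eigenvalues_ne_zero_of_mulVec_injective fun v hv =>
      eq_zero_of_fromBlocks_mulVec_eq_zero hpos (by simpa using hA) hv
    have hp := hK.card_pos_eigenvalues_add_finrank_le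
      (V := (⊥ : Submodule ℝ (Fin n → ℝ)).comap (LinearMap.funLeft ℝ ℝ Sum.inl)) fun v hv => by
        have hx : v ∘ Sum.inl = 0 := hv
        rw [dotProduct_fromBlocks_mulVec_of_mulVec_eq_zero H A (by simp [hx]), hx,
          zero_dotProduct]
    have hn := hK.card_neg_eigenvalues_add_finrank_le
      (V := (LinearMap.ker A.mulVecLin).comap (LinearMap.funLeft ℝ ℝ Sum.inl)) fun v hv => by
        have hx : A *ᵥ (v ∘ Sum.inl) = 0 := hv
        rw [dotProduct_fromBlocks_mulVec_of_mulVec_eq_zero H A hx]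
        rcases eq_or_ne (v ∘ Sum.inl) 0 with h0 | h0
        · simp [h0]
        · exact (hpos _ hx h0).le
    have hp' := finrank_add_card_le_finrank_comap_inl (κ := Fin m) (⊥ : Submodule ℝ (Fin n → ℝ))
    have hn' := finrank_add_card_le_finrank_comap_inl (κ := Fin m) (LinearMap.ker A.mulVecLin)
    have hkerA := A.mulVecLin.finrank_range_add_finrank_ker
    have hrA : Module.finrank ℝ (LinearMap.range A.mulVecLin) = m := hA
    have hsum := Finset.card_filter_add_card_filter_not (s := Finset.univ)
      (fun i => 0 < hK.eigenvalues i)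
    have hnot : (Finset.univ.filter fun i => ¬ 0 < hK.eigenvalues i) =
        Finset.univ.filter fun i => hK.eigenvalues i < 0 :=
      Finset.filter_congr fun i _ => by rw [not_lt, le_iff_lt_or_eq, or_iff_left (hne i)]
    rw [hnot] at hsum
    simp only [Finset.card_univ, Fintype.card_sum, Fintype.card_fin, finrank_bot,
      Module.finrank_fintype_fun_eq_card] at hp hn hp' hn' hkerA hsum
    exact ⟨by omega, by omega, by simp [hne]⟩
  · rintro ⟨hp, -, -⟩ x hAx hx
    by_contra! hneg
    have h := hK.card_pos_eigenvalues_add_finrank_le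
      (V := (ℝ ∙ x).comap (LinearMap.funLeft ℝ ℝ Sum.inl)) fun v hv => by
        obtain ⟨c, hc⟩ := Submodule.mem_span_singleton.mp hv
        replace hc : v ∘ Sum.inl = c • x := hc.symm
        rw [dotProduct_fromBlocks_mulVec_of_mulVec_eq_zero H A (by simp [hc, mulVec_smul, hAx]),
          hc, mulVec_smul, smul_dotProduct, dotProduct_smul, smul_smul, smul_eq_mul]
        exact mul_nonpos_of_nonneg_of_nonpos (mul_self_nonneg c) hneg
    have h' := finrank_add_card_le_finrank_comap_inl (κ := Fin m) (ℝ ∙ x)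
    rw [finrank_span_singleton hx] at h'
    simp only [Fintype.card_sum, Fintype.card_fin] at h h'
    omega
end

section
/- Let H be a real symmetric n × n matrix, let A be a real m × n matrix of full row rank m (m ≤ n), and let Z be a real n × (n−m) matrix whose columns form a basis of the nullspace of A. If the reduced Hessian ZᵀHZ is positive definite, then the KKT matrix K = [[H, Aᵀ], [A, 0]] is invertible. -/
open Matrix

/-- If the reduced Hessian `ZᵀHZ` is positive definite, then the
KKT matrix `K = [[H, Aᵀ], [A, 0]]` is invertible. -/
theorem statement5 (n m : ℕ) (hmn : m ≤ n)
    (H : Matrix (Fin n) (Fin n) ℝ) (hH : H.IsSymm)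
    (A : Matrix (Fin m) (Fin n) ℝ) (hA : A.rank = m)
    (Z : Matrix (Fin n) (Fin (n - m)) ℝ)
    (hZind : LinearIndependent ℝ (fun j : Fin (n - m) => fun i : Fin n => Z i j))
    (hZspan : Submodule.span ℝ
        (Set.range (fun j : Fin (n - m) => fun i : Fin n => Z i j)) =
      LinearMap.ker A.mulVecLin)
    (hpos : (Zᵀ * H * Z).PosDef) :
    IsUnit (Matrix.fromBlocks H Aᵀ A 0) := by
  have hAT : Function.Injective Aᵀ.mulVec := by
    rw [mulVec_injective_iff, col_transpose, linearIndependent_iff_card_eq_finrank_span,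
      Fintype.card_fin, Set.finrank, ← A.rank_eq_finrank_span_row, hA]
  rw [← mulVec_injective_iff_isUnit]
  refine (injective_iff_map_eq_zero (fromBlocks H Aᵀ A 0).mulVecLin).2 fun w hw => ?_
  rw [mulVecLin_apply, fromBlocks_mulVec, ← Sum.elim_zero_zero, Sum.elim_eq_iff] at hw
  obtain ⟨hHx, hAx⟩ := hw
  set x := w ∘ Sum.inl with hx
  set y := w ∘ Sum.inr with hy
  rw [zero_mulVec, add_zero] at hAx
  obtain ⟨v, hv⟩ : x ∈ LinearMap.range Z.mulVecLin := by
    rw [range_mulVecLin]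
    exact hZspan.symm ▸ hAx
  rw [mulVecLin_apply] at hv
  have hxHx : x ⬝ᵥ H *ᵥ x = 0 := by
    have h := congrArg (x ⬝ᵥ ·) hHx
    simpa [dotProduct_add, dotProduct_mulVec x Aᵀ, vecMul_transpose, hAx] using h
  have hv0 : v = 0 := by
    by_contra hne
    have h := hpos.dotProduct_mulVec_pos hne
    rw [star_trivial, ← mulVec_mulVec, ← mulVec_mulVec, dotProduct_mulVec, vecMul_transpose,
      hv, hxHx] at h
    exact h.false
  have hx0 : x = 0 := by rw [← hv, hv0, mulVec_zero]
  have hy0 : y = 0 := by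
    apply hAT
    simpa [hx0] using hHx
  rw [← Sum.elim_comp_inl_inr w, ← hx, ← hy, hx0, hy0, Sum.elim_zero_zero]
end

section
/- Consider the equality-constrained quadratic program: minimize (1/2)·xᵀHx + hᵀx over x ∈ ℝⁿ subject to Ax + a = 0, where H is a real symmetric n × n matrix, h ∈ ℝⁿ, A is a real m × n matrix of full row rank m (m ≤ n), and a ∈ ℝᵐ. Let Z be a real n × (n−m) matrix whose columns form a basis of the nullspace of A. Then the problem has a unique minimizer — i.e., there is a unique feasible point x* with (1/2)·x*ᵀHx* + hᵀx* ≤ (1/2)·xᵀHx + hᵀx for every feasible x, with strict inequality for every feasible x ≠ x* — if and only if the reduced Hessian ZᵀHZ is positive definite. -/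
open Matrix

/-- Exact second-order expansion of a quadratic function with symmetric Hessian. -/
lemma quadratic_add {n : ℕ} {H : Matrix (Fin n) (Fin n) ℝ} (hH : H.IsSymm)
    (h x p : Fin n → ℝ) :
    (1 / 2) * ((x + p) ⬝ᵥ H.mulVec (x + p)) + h ⬝ᵥ (x + p) =
      (1 / 2) * (x ⬝ᵥ H.mulVec x) + h ⬝ᵥ x + p ⬝ᵥ (H.mulVec x + h) +
        (1 / 2) * (p ⬝ᵥ H.mulVec p) := by
  have hsymm : x ⬝ᵥ H.mulVec p = p ⬝ᵥ H.mulVec x := by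
    rw [dotProduct_mulVec, ← mulVec_transpose, hH.eq, dotProduct_comm]
  simp only [mulVec_add, dotProduct_add, add_dotProduct, hsymm, dotProduct_comm h p]
  ring

/-- The quadratic form of a reduced matrix is the original form on the column space. -/
lemma dotProduct_transpose_mul_mul_mulVec {n k : ℕ} (H : Matrix (Fin n) (Fin n) ℝ)
    (Z : Matrix (Fin n) (Fin k) ℝ) (v : Fin k → ℝ) :
    v ⬝ᵥ (Zᵀ * H * Z).mulVec v = Z.mulVec v ⬝ᵥ H.mulVec (Z.mulVec v) := by
  rw [← mulVec_mulVec, ← mulVec_mulVec, dotProduct_mulVec, vecMul_transpose]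

/-- A matrix of full row rank is surjective. -/
lemma mulVec_surjective_of_rank_eq {m n : ℕ} {A : Matrix (Fin m) (Fin n) ℝ}
    (hA : A.rank = m) : Function.Surjective A.mulVec := by
  have hrange : LinearMap.range A.mulVecLin = ⊤ := by
    apply Submodule.eq_top_of_finrank_eq
    simpa [Matrix.rank] using hA
  exact LinearMap.range_eq_top.mp hrange

/-- The equality-constrained QP
`min (1/2)xᵀHx + hᵀx  s.t.  Ax + a = 0` (with `A` of full row rank) has a unique
minimizer if and only if the reduced Hessian `ZᵀHZ` is positive definite,
where `Z` is a matrix whose columns form a basis of the nullspace of `A`. -/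
theorem statement6 (n m : ℕ) (hmn : m ≤ n)
    (H : Matrix (Fin n) (Fin n) ℝ) (hH : H.IsSymm)
    (h : Fin n → ℝ)
    (A : Matrix (Fin m) (Fin n) ℝ) (a : Fin m → ℝ) (hA : A.rank = m)
    (Z : Matrix (Fin n) (Fin (n - m)) ℝ)
    (hZind : LinearIndependent ℝ (fun j : Fin (n - m) => fun i : Fin n => Z i j))
    (hZspan : Submodule.span ℝ
        (Set.range (fun j : Fin (n - m) => fun i : Fin n => Z i j)) =
      LinearMap.ker A.mulVecLin) :
    (∃! xs : Fin n → ℝ,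
        A.mulVec xs + a = 0 ∧
        (∀ x : Fin n → ℝ, A.mulVec x + a = 0 →
          (1 / 2) * (xs ⬝ᵥ H.mulVec xs) + h ⬝ᵥ xs ≤
            (1 / 2) * (x ⬝ᵥ H.mulVec x) + h ⬝ᵥ x) ∧
        (∀ x : Fin n → ℝ, A.mulVec x + a = 0 → x ≠ xs →
          (1 / 2) * (xs ⬝ᵥ H.mulVec xs) + h ⬝ᵥ xs <
            (1 / 2) * (x ⬝ᵥ H.mulVec x) + h ⬝ᵥ x)) ↔
    (Zᵀ * H * Z).PosDef := by
  have hker : ∀ p : Fin n → ℝ, A.mulVec p = 0 ↔ ∃ v, Z.mulVec v = p := by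
    intro p
    have hrange : LinearMap.range Z.mulVecLin = LinearMap.ker A.mulVecLin := by
      rw [range_mulVecLin]
      exact hZspan
    simpa using (SetLike.ext_iff.mp hrange p).symm
  have hinj : Function.Injective Z.mulVec := mulVec_injective_iff.mpr hZind
  have hHerm : (Zᵀ * H * Z).IsHermitian := by
    simp [IsHermitian, conjTranspose_eq_transpose_of_trivial, transpose_mul, hH.eq,
      Matrix.mul_assoc]
  constructor
  · rintro ⟨xs, ⟨hfeas, -, hlt⟩, -⟩
    refine PosDef.of_dotProduct_mulVec_pos hHerm fun v hv => ?_
    rw [star_trivial, dotProduct_transpose_mul_mul_mulVec]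
    have hp : Z.mulVec v ≠ 0 := fun h0 => hv (hinj (by simpa using h0))
    have hAp : A.mulVec (Z.mulVec v) = 0 := (hker _).mpr ⟨v, rfl⟩
    generalize Z.mulVec v = p at hp hAp
    have h1 := hlt (xs + p) (by simpa [mulVec_add, hAp] using hfeas) (by simpa using hp)
    have h2 := hlt (xs + -p) (by simpa [mulVec_add, mulVec_neg, hAp] using hfeas)
      (by simpa using hp)
    rw [quadratic_add hH] at h1 h2
    simp only [mulVec_neg, neg_dotProduct, dotProduct_neg, neg_neg] at h2
    linarith
  · intro hR
    obtain ⟨x₀, hx₀⟩ := mulVec_surjective_of_rank_eq hA (-a)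
    obtain ⟨u, hu⟩ := mulVec_surjective_iff_isUnit.mpr hR.isUnit
      (-Zᵀ.mulVec (H.mulVec x₀ + h))
    have hgrad : Zᵀ.mulVec (H.mulVec (x₀ + Z.mulVec u) + h) = 0 := by
      rw [← mulVec_mulVec, ← mulVec_mulVec] at hu
      rw [mulVec_add H, add_right_comm, mulVec_add, hu, add_neg_cancel]
    have hfeas : A.mulVec (x₀ + Z.mulVec u) + a = 0 := by
      rw [mulVec_add, hx₀, (hker _).mpr ⟨u, rfl⟩, add_zero, neg_add_cancel]
    generalize x₀ + Z.mulVec u = xs at hgrad hfeas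
    have hlt : ∀ x : Fin n → ℝ, A.mulVec x + a = 0 → x ≠ xs →
        (1 / 2) * (xs ⬝ᵥ H.mulVec xs) + h ⬝ᵥ xs <
          (1 / 2) * (x ⬝ᵥ H.mulVec x) + h ⬝ᵥ x := by
      intro x hx hne
      obtain ⟨w, hw⟩ := (hker (x - xs)).mp (by
        rw [mulVec_sub, eq_neg_of_add_eq_zero_left hx, eq_neg_of_add_eq_zero_left hfeas,
          sub_self])
      obtain rfl : x = xs + Z.mulVec w := by rw [hw, add_sub_cancel]
      have hw0 : w ≠ 0 := by
        rintro rfl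
        simp at hne
      have hpos := hR.dotProduct_mulVec_pos hw0
      rw [star_trivial, dotProduct_transpose_mul_mul_mulVec] at hpos
      have hcross : Z.mulVec w ⬝ᵥ (H.mulVec xs + h) = 0 := by
        rw [← vecMul_transpose, ← dotProduct_mulVec, hgrad, dotProduct_zero]
      rw [quadratic_add hH, hcross]
      linarith
    refine ⟨xs, ⟨hfeas, fun x hx => ?_, hlt⟩, fun y ⟨hy, hle, _⟩ => ?_⟩
    · rcases eq_or_ne x xs with rfl | hne
      · exact le_rfl
      · exact (hlt x hx hne).le
    · by_contra hne
      exact (hlt y hy hne).not_ge (hle xs hfeas)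
end

section
/- Let H be a real symmetric n × n matrix, let A be a real m_A × n matrix and B a real m_B × n matrix such that the stacked (m_A + m_B) × n matrix C = [A; B] has full row rank m_A + m_B. Let Z be a real n × (n − m_A − m_B) matrix whose columns form a basis of the nullspace of C, let Z_B be a real n × (n − m_B) matrix whose columns form a basis of the nullspace of B, and let Ẑ be a real (n − m_B) × (n − m_A − m_B) matrix whose columns form a basis of the nullspace of A·Z_B. Then the reduced Hessian ZᵀHZ is positive definite if and only if the reduced Hessian Ẑᵀ(Z_BᵀHZ_B)Ẑ of the substituted system is positive definite. -/
open Matrix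

/-- Congruence by an injective matrix `W` is positive definite exactly when the quadratic form
of `H` is positive on the nonzero vectors of the column space of `W`. -/
theorem posDef_transpose_mul_mul_iff_s7 {m k : Type*} [Fintype m] [Fintype k]
    {H : Matrix m m ℝ} (hH : H.IsSymm) {W : Matrix m k ℝ}
    (hW : Function.Injective W.mulVec) :
    (Wᵀ * H * W).PosDef ↔
      ∀ v ∈ LinearMap.range W.mulVecLin, v ≠ 0 → 0 < v ⬝ᵥ H *ᵥ v := by
  have key (x : k → ℝ) : x ⬝ᵥ (Wᵀ * H * W) *ᵥ x = (W *ᵥ x) ⬝ᵥ H *ᵥ (W *ᵥ x) := by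
    rw [Matrix.mul_assoc, ← mulVec_mulVec, ← mulVec_mulVec, dotProduct_mulVec, vecMul_transpose]
  have hne (x : k → ℝ) : W *ᵥ x ≠ 0 ↔ x ≠ 0 := by
    rw [not_iff_not]
    exact ⟨fun h => hW (by simpa using h), fun h => by simp [h]⟩
  have hherm : (Wᵀ * H * W).IsHermitian := by
    simp [IsHermitian, conjTranspose_eq_transpose_of_trivial, transpose_mul, hH.eq,
      Matrix.mul_assoc]
  rw [posDef_iff_dotProduct_mulVec]
  constructor
  · rintro ⟨-, h⟩ v ⟨x, rfl⟩ hv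
    simpa [key] using h ((hne x).1 hv)
  · intro h
    refine ⟨hherm, fun x hx => ?_⟩
    simpa [key] using h (W *ᵥ x) ⟨x, rfl⟩ ((hne x).2 hx)

/-- Composing a matrix whose column space is `ker B` with one whose column space is
`ker (A * W)` yields a matrix whose column space is the kernel of the stacked matrix. -/
theorem range_mulVecLin_mul_eq_ker_fromRows {a b m k l : Type*}
    [Fintype m] [Fintype k] [Fintype l]
    {A : Matrix a m ℝ} {B : Matrix b m ℝ} {W : Matrix m k ℝ} {V : Matrix k l ℝ}
    (hW : LinearMap.range W.mulVecLin = LinearMap.ker B.mulVecLin)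
    (hV : LinearMap.range V.mulVecLin = LinearMap.ker (A * W).mulVecLin) :
    LinearMap.range (W * V).mulVecLin = LinearMap.ker (fromRows A B).mulVecLin := by
  have hker (v : m → ℝ) : v ∈ LinearMap.ker (fromRows A B).mulVecLin ↔
      A *ᵥ v = 0 ∧ B *ᵥ v = 0 := by
    rw [LinearMap.mem_ker, mulVecLin_apply, fromRows_mulVec]
    simp [funext_iff]
  ext v
  rw [hker]
  constructor
  · rintro ⟨x, rfl⟩
    have h₁ : V *ᵥ x ∈ LinearMap.ker (A * W).mulVecLin := hV ▸ ⟨x, rfl⟩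
    have h₂ : W *ᵥ (V *ᵥ x) ∈ LinearMap.ker B.mulVecLin := hW ▸ ⟨V *ᵥ x, rfl⟩
    simp only [LinearMap.mem_ker, mulVecLin_apply, ← mulVec_mulVec] at h₁ h₂ ⊢
    exact ⟨h₁, h₂⟩
  · rintro ⟨hA, hB⟩
    have hv : v ∈ LinearMap.range W.mulVecLin := by rw [hW]; exact hB
    obtain ⟨y, rfl⟩ := hv
    have hy : y ∈ LinearMap.range V.mulVecLin := by
      rw [hV, LinearMap.mem_ker, mulVecLin_apply, ← mulVec_mulVec]
      exact hA
    obtain ⟨x, rfl⟩ := hy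
    exact ⟨x, by simp⟩

/-- (Substitution step.) With `C = [A; B]` of full row rank,
`Z` a nullspace basis of `C`, `Z_B` a nullspace basis of `B`, and `Ẑ` a nullspace
basis of `A·Z_B`, the reduced Hessian `ZᵀHZ` is positive definite if and only if
the reduced Hessian `Ẑᵀ(Z_BᵀHZ_B)Ẑ` of the substituted KKT system is positive
definite. -/
theorem statement7 (n mA mB : ℕ)
    (H : Matrix (Fin n) (Fin n) ℝ) (hH : H.IsSymm)
    (A : Matrix (Fin mA) (Fin n) ℝ) (B : Matrix (Fin mB) (Fin n) ℝ)
    (hC : (Matrix.fromRows A B).rank = mA + mB)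
    (Z : Matrix (Fin n) (Fin (n - mA - mB)) ℝ)
    (hZind : LinearIndependent ℝ
      (fun j : Fin (n - mA - mB) => fun i : Fin n => Z i j))
    (hZspan : Submodule.span ℝ
        (Set.range (fun j : Fin (n - mA - mB) => fun i : Fin n => Z i j)) =
      LinearMap.ker (Matrix.fromRows A B).mulVecLin)
    (Z_B : Matrix (Fin n) (Fin (n - mB)) ℝ)
    (hZBind : LinearIndependent ℝ
      (fun j : Fin (n - mB) => fun i : Fin n => Z_B i j))
    (hZBspan : Submodule.span ℝ
        (Set.range (fun j : Fin (n - mB) => fun i : Fin n => Z_B i j)) =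
      LinearMap.ker B.mulVecLin)
    (Zhat : Matrix (Fin (n - mB)) (Fin (n - mA - mB)) ℝ)
    (hZhatind : LinearIndependent ℝ
      (fun j : Fin (n - mA - mB) => fun i : Fin (n - mB) => Zhat i j))
    (hZhatspan : Submodule.span ℝ
        (Set.range (fun j : Fin (n - mA - mB) => fun i : Fin (n - mB) => Zhat i j)) =
      LinearMap.ker (A * Z_B).mulVecLin) :
    (Zᵀ * H * Z).PosDef ↔ (Zhatᵀ * (Z_Bᵀ * H * Z_B) * Zhat).PosDef := by
  have hZ : Function.Injective Z.mulVec := mulVec_injective_iff.2 hZind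
  have hZB : Function.Injective Z_B.mulVec := mulVec_injective_iff.2 hZBind
  have hZhat : Function.Injective Zhat.mulVec := mulVec_injective_iff.2 hZhatind
  have hprod : Function.Injective (Z_B * Zhat).mulVec := by
    intro x y hxy
    simp only [← mulVec_mulVec] at hxy
    exact hZhat (hZB hxy)
  have hrange : LinearMap.range (Z_B * Zhat).mulVecLin = LinearMap.range Z.mulVecLin :=
    (range_mulVecLin_mul_eq_ker_fromRows ((range_mulVecLin Z_B).trans hZBspan)
      ((range_mulVecLin Zhat).trans hZhatspan)).trans
      ((range_mulVecLin Z).trans hZspan).symm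
  have hassoc : Zhatᵀ * (Z_Bᵀ * H * Z_B) * Zhat = (Z_B * Zhat)ᵀ * H * (Z_B * Zhat) := by
    simp only [transpose_mul, Matrix.mul_assoc]
  rw [hassoc, posDef_transpose_mul_mul_iff_s7 hH hZ, posDef_transpose_mul_mul_iff_s7 hH hprod, hrange]
end

section
/- Let H be a real symmetric n_H × n_H matrix, G a real symmetric n_G × n_G matrix, S a real n_G × n_H matrix, and A a real m × n_G matrix of full row rank m. Let Z_A be a real n_G × (n_G − m) matrix whose columns form a basis of the nullspace of A, and set Z = [[I_{n_H}, 0], [0, Z_A]]. Then the reduced Hessian Zᵀ·[[H, Sᵀ], [S, G]]·Z of the KKT matrix K_c = [[H, Sᵀ, 0], [S, G, Aᵀ], [0, A, 0]] is positive definite if and only if H is positive definite and the reduced Hessian Z_Aᵀ·(G − S·H⁻¹·Sᵀ)·Z_A of the Schur-complemented KKT matrix K̂_c = [[G − S·H⁻¹·Sᵀ, Aᵀ], [A, 0]] is positive definite. -/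
open Matrix

section PosDefBlocks

variable {m n K : Type*} [Fintype m] [Fintype n]

/-- A block-diagonal matrix is positive definite iff both diagonal blocks are. -/
theorem Matrix.posDef_fromBlocks_zero_iff [Ring K] [PartialOrder K] [StarRing K]
    [StarOrderedRing K] {A : Matrix m m K} {D : Matrix n n K} :
    (fromBlocks A 0 0 D).PosDef ↔ A.PosDef ∧ D.PosDef := by
  refine ⟨fun h => ⟨h.submatrix Sum.inl_injective, h.submatrix Sum.inr_injective⟩, ?_⟩
  rintro ⟨hA, hD⟩
  refine .of_dotProduct_mulVec_pos (hA.isHermitian.fromBlocks (by simp) hD.isHermitian) ?_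
  intro x hx
  obtain ⟨u, v, rfl⟩ : ∃ u v, x = Sum.elim u v := ⟨_, _, (Sum.elim_comp_inl_inr x).symm⟩
  have hsum : star (Sum.elim u v) ⬝ᵥ (fromBlocks A 0 0 D *ᵥ Sum.elim u v) =
      star u ⬝ᵥ (A *ᵥ u) + star v ⬝ᵥ (D *ᵥ v) := by
    simp [fromBlocks_mulVec, dotProduct]
  rw [hsum]
  by_cases hu : u = 0
  · have hv : v ≠ 0 := by
      rintro rfl
      exact hx (by simp [hu])
    simpa [hu] using hD.dotProduct_mulVec_pos hv
  · exact add_pos_of_pos_of_nonneg (hA.dotProduct_mulVec_pos hu)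
      (hD.posSemidef.dotProduct_mulVec_nonneg v)

/-- **Schur complement criterion** for positive definiteness. -/
theorem Matrix.posDef_fromBlocks_iff_posDef_schur [DecidableEq m] [DecidableEq n] [Field K]
    [PartialOrder K] [StarRing K] [StarOrderedRing K]
    (A : Matrix m m K) (B : Matrix m n K) (D : Matrix n n K) :
    (fromBlocks A B Bᴴ D).PosDef ↔ A.PosDef ∧ (D - Bᴴ * A⁻¹ * B).PosDef := by
  suffices h : A.PosDef →
      ((fromBlocks A B Bᴴ D).PosDef ↔ A.PosDef ∧ (D - Bᴴ * A⁻¹ * B).PosDef) from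
    ⟨fun hM => (h (hM.submatrix Sum.inl_injective)).mp hM, fun hAD => (h hAD.1).mpr hAD⟩
  intro hA
  have : Invertible A := hA.isUnit.invertible
  have hU : IsUnit (fromBlocks 1 (A⁻¹ * B) 0 1 : Matrix (m ⊕ n) (m ⊕ n) K) :=
    isUnit_fromBlocks_zero₂₁.mpr ⟨isUnit_one, isUnit_one⟩
  have hLDU : fromBlocks A B Bᴴ D = star (fromBlocks 1 (A⁻¹ * B) 0 1) *
      fromBlocks A 0 0 (D - Bᴴ * A⁻¹ * B) * fromBlocks 1 (A⁻¹ * B) 0 1 := by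
    rw [fromBlocks_eq_of_invertible₁₁ A B Bᴴ D, star_eq_conjTranspose, fromBlocks_conjTranspose,
      conjTranspose_mul, hA.isHermitian.inv.eq]
    simp [invOf_eq_nonsing_inv]
  rw [hLDU, hU.posDef_star_left_conjugate_iff, posDef_fromBlocks_zero_iff]

end PosDefBlocks

/-- The reduced Hessian `Zᵀ·[[H, Sᵀ], [S, G]]·Z`
(with `Z = [[I, 0], [0, Z_A]]`, `Z_A` a nullspace basis of `A`) of the KKT matrix
`K_c = [[H, Sᵀ, 0], [S, G, Aᵀ], [0, A, 0]]` is positive definite if and only if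
`H` is positive definite and the reduced Hessian `Z_Aᵀ·(G − S·H⁻¹·Sᵀ)·Z_A` of
the Schur-complemented KKT matrix is positive definite. -/
theorem statement10 (nH nG m : ℕ) (hm : m ≤ nG)
    (H : Matrix (Fin nH) (Fin nH) ℝ) (hH : H.IsSymm)
    (G : Matrix (Fin nG) (Fin nG) ℝ) (hG : G.IsSymm)
    (S : Matrix (Fin nG) (Fin nH) ℝ)
    (A : Matrix (Fin m) (Fin nG) ℝ) (hA : A.rank = m)
    (Z_A : Matrix (Fin nG) (Fin (nG - m)) ℝ)
    (hZind : LinearIndependent ℝ (fun j : Fin (nG - m) => fun i : Fin nG => Z_A i j))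
    (hZspan : Submodule.span ℝ
        (Set.range (fun j : Fin (nG - m) => fun i : Fin nG => Z_A i j)) =
      LinearMap.ker A.mulVecLin) :
    ((Matrix.fromBlocks (1 : Matrix (Fin nH) (Fin nH) ℝ) 0 0 Z_A)ᵀ *
        Matrix.fromBlocks H Sᵀ S G *
        Matrix.fromBlocks (1 : Matrix (Fin nH) (Fin nH) ℝ) 0 0 Z_A).PosDef ↔
      (H.PosDef ∧ (Z_Aᵀ * (G - S * H⁻¹ * Sᵀ) * Z_A).PosDef) := by
  have hblock : (fromBlocks (1 : Matrix (Fin nH) (Fin nH) ℝ) 0 0 Z_A)ᵀ * fromBlocks H Sᵀ S G *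
      fromBlocks (1 : Matrix (Fin nH) (Fin nH) ℝ) 0 0 Z_A =
      fromBlocks H (Sᵀ * Z_A) (Sᵀ * Z_A)ᴴ (Z_Aᵀ * G * Z_A) := by
    simp [fromBlocks_transpose, fromBlocks_multiply, conjTranspose_eq_transpose_of_trivial]
  have hschur : Z_Aᵀ * G * Z_A - (Sᵀ * Z_A)ᴴ * H⁻¹ * (Sᵀ * Z_A) =
      Z_Aᵀ * (G - S * H⁻¹ * Sᵀ) * Z_A := by
    simp [Matrix.mul_sub, Matrix.sub_mul, Matrix.mul_assoc,
      conjTranspose_eq_transpose_of_trivial]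
  rw [hblock, posDef_fromBlocks_iff_posDef_schur, hschur]
end

section
/- Let H and Ĥ be real symmetric n × n matrices, let A and Â be real m × n matrices of full row rank m, and let M be an invertible real (n+m) × (n+m) matrix such that Mᵀ·[[H, Aᵀ], [A, 0]]·M = [[Ĥ, Âᵀ], [Â, 0]]. Let Z and Ẑ be real n × (n−m) matrices whose columns form bases of the nullspaces of A and Â, respectively. Then the reduced Hessian ZᵀHZ is positive definite if and only if the reduced Hessian ẐᵀĤẐ is positive definite. -/
open Matrix

/-- A real matrix of full row rank has a right inverse. -/
lemma exists_right_inverse_of_rank_eq {m n : ℕ} {A : Matrix (Fin m) (Fin n) ℝ}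
    (hA : A.rank = m) : ∃ G : Matrix (Fin n) (Fin m) ℝ, A * G = 1 := by
  rw [← Matrix.mulVec_surjective_iff_exists_right_inverse]
  have h : LinearMap.range A.mulVecLin = ⊤ := by
    apply Submodule.eq_top_of_finrank_eq
    rw [← Matrix.rank, hA, Module.finrank_fin_fun]
  exact LinearMap.range_eq_top.mp h

/-- A reduced Hessian is positive definite iff the quadratic form of the Hessian is positive on the
nonzero vectors of the nullspace. -/
lemma posDef_reduced_iff {m n k : ℕ} {H : Matrix (Fin n) (Fin n) ℝ} (hH : H.IsSymm)
    (A : Matrix (Fin m) (Fin n) ℝ) (Z : Matrix (Fin n) (Fin k) ℝ)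
    (hZind : LinearIndependent ℝ (fun j : Fin k => fun i : Fin n => Z i j))
    (hZspan : Submodule.span ℝ (Set.range (fun j : Fin k => fun i : Fin n => Z i j)) =
      LinearMap.ker A.mulVecLin) :
    (Zᵀ * H * Z).PosDef ↔ ∀ x, A *ᵥ x = 0 → x ≠ 0 → 0 < x ⬝ᵥ H *ᵥ x := by
  have hherm : (Zᵀ * H * Z).IsHermitian := by
    simp [Matrix.IsHermitian, conjTranspose_eq_transpose_of_trivial, hH.eq, Matrix.mul_assoc]
  have hinj : Function.Injective Z.mulVec := Matrix.mulVec_injective_iff.mpr hZind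
  have hquad : ∀ u, u ⬝ᵥ (Zᵀ * H * Z) *ᵥ u = (Z *ᵥ u) ⬝ᵥ H *ᵥ (Z *ᵥ u) := by
    intro u
    rw [← mulVec_mulVec, ← mulVec_mulVec, dotProduct_mulVec, vecMul_transpose]
  have hmem : ∀ x, A *ᵥ x = 0 ↔ ∃ u, Z *ᵥ u = x := by
    intro x
    have h : LinearMap.ker A.mulVecLin = LinearMap.range Z.mulVecLin := by
      rw [← hZspan, Matrix.range_mulVecLin]; rfl
    simpa using SetLike.ext_iff.mp h x
  rw [Matrix.posDef_iff_dotProduct_mulVec]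
  constructor
  · rintro ⟨-, hpos⟩ x hx hx0
    obtain ⟨u, rfl⟩ := (hmem x).mp hx
    rw [← hquad]
    have hu : u ≠ 0 := by rintro rfl; simp at hx0
    simpa using hpos hu
  · refine fun h => ⟨hherm, fun {u} hu => ?_⟩
    rw [star_trivial, hquad]
    refine h _ ((hmem _).mpr ⟨u, rfl⟩) fun h0 => hu (hinj ?_)
    simpa using h0

/-- The quadratic form of a KKT matrix. -/
lemma dotProduct_fromBlocks_mulVec {m n : ℕ} (H : Matrix (Fin n) (Fin n) ℝ)
    (A : Matrix (Fin m) (Fin n) ℝ) (x : Fin n → ℝ) (y : Fin m → ℝ) :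
    Sum.elim x y ⬝ᵥ fromBlocks H Aᵀ A 0 *ᵥ Sum.elim x y =
      x ⬝ᵥ H *ᵥ x + 2 * (y ⬝ᵥ A *ᵥ x) := by
  have h : x ⬝ᵥ Aᵀ *ᵥ y = y ⬝ᵥ A *ᵥ x := by
    rw [dotProduct_mulVec, vecMul_transpose, dotProduct_comm]
  rw [fromBlocks_mulVec, sumElim_dotProduct_sumElim]
  simp only [Sum.elim_comp_inl, Sum.elim_comp_inr, zero_mulVec, add_zero, dotProduct_add, h]
  ring

/-- If the Hessian is positive definite on the nullspace of a full-row-rank Jacobian, the KKT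
matrix is positive definite on the graph of some matrix. -/
lemma exists_graph_pos {m n : ℕ} {H : Matrix (Fin n) (Fin n) ℝ} (hH : H.IsSymm)
    {A : Matrix (Fin m) (Fin n) ℝ} (hA : A.rank = m)
    (hpos : ∀ x, A *ᵥ x = 0 → x ≠ 0 → 0 < x ⬝ᵥ H *ᵥ x) :
    ∃ B : Matrix (Fin m) (Fin n) ℝ, ∀ x, x ≠ 0 →
      0 < x ⬝ᵥ H *ᵥ x + 2 * (B *ᵥ x ⬝ᵥ A *ᵥ x) := by
  obtain ⟨G, hG⟩ := exists_right_inverse_of_rank_eq hA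
  refine ⟨(1 / 2 : ℝ) • A - Gᵀ * (H - (1 / 2 : ℝ) • (H * (G * A))), fun x hx => ?_⟩
  set w := G *ᵥ A *ᵥ x with hw
  set p := x - w with hp
  have hAp : A *ᵥ p = 0 := by
    rw [hp, hw, mulVec_sub, mulVec_mulVec _ A G, hG, one_mulVec, sub_self]
  have hsymm : ∀ u v, u ⬝ᵥ H *ᵥ v = v ⬝ᵥ H *ᵥ u := by
    intro u v
    rw [dotProduct_mulVec, ← mulVec_transpose, hH.eq, dotProduct_comm]
  have key : x ⬝ᵥ H *ᵥ x +
      2 * (((1 / 2 : ℝ) • A - Gᵀ * (H - (1 / 2 : ℝ) • (H * (G * A)))) *ᵥ x ⬝ᵥ A *ᵥ x) =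
      p ⬝ᵥ H *ᵥ p + A *ᵥ x ⬝ᵥ A *ᵥ x := by
    have hT : ∀ v : Fin n → ℝ, Gᵀ *ᵥ v ⬝ᵥ A *ᵥ x = w ⬝ᵥ v := by
      intro v
      rw [mulVec_transpose, ← dotProduct_mulVec, dotProduct_comm]
    simp only [sub_mulVec, smul_mulVec, ← mulVec_mulVec, sub_dotProduct, smul_dotProduct, hT,
      dotProduct_sub, dotProduct_smul, hp, mulVec_sub, ← hw, smul_eq_mul]
    rw [hsymm x w]
    ring
  rw [key]
  by_cases hp0 : p = 0
  · have hAx : A *ᵥ x ≠ 0 := by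
      intro h
      apply hx
      rw [hw, h, mulVec_zero] at hp
      rw [← sub_zero x, ← hp, hp0]
    have hsq : 0 < A *ᵥ x ⬝ᵥ A *ᵥ x := by
      simpa using dotProduct_star_self_pos_iff.mpr hAx
    simpa [hp0] using hsq
  · have hsq : 0 ≤ A *ᵥ x ⬝ᵥ A *ᵥ x := by
      simpa using dotProduct_star_self_nonneg (A *ᵥ x)
    linarith [hpos p hAp hp0]

/-- Positivity of the Hessian on the nullspace of the Jacobian is carried along by a congruence
of KKT matrices. -/
lemma pos_on_ker_of_congr {m n : ℕ} {H H' : Matrix (Fin n) (Fin n) ℝ} (hH : H.IsSymm)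
    {A A' : Matrix (Fin m) (Fin n) ℝ} (hA : A.rank = m)
    {M : Matrix (Fin n ⊕ Fin m) (Fin n ⊕ Fin m) ℝ} (hM : IsUnit M)
    (hcong : Mᵀ * fromBlocks H Aᵀ A 0 * M = fromBlocks H' A'ᵀ A' 0)
    (hpos : ∀ x, A *ᵥ x = 0 → x ≠ 0 → 0 < x ⬝ᵥ H *ᵥ x) :
    ∀ x, A' *ᵥ x = 0 → x ≠ 0 → 0 < x ⬝ᵥ H' *ᵥ x := by
  intro z hz hz0
  by_contra! hneg
  obtain ⟨B, hB⟩ := exists_graph_pos hH hA hpos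
  let f : ((Fin n → ℝ) × ℝ × (Fin m → ℝ)) →ₗ[ℝ] (Fin n ⊕ Fin m → ℝ) :=
    { toFun := fun v => Sum.elim v.1 (B *ᵥ v.1) - M *ᵥ Sum.elim (v.2.1 • z) v.2.2
      map_add' := by
        intro u v
        have h₁ : Sum.elim (u + v).1 (B *ᵥ (u + v).1) =
            Sum.elim u.1 (B *ᵥ u.1) + Sum.elim v.1 (B *ᵥ v.1) := by
          ext (i | i) <;> simp [mulVec_add]
        have h₂ : Sum.elim ((u + v).2.1 • z) (u + v).2.2 =
            Sum.elim (u.2.1 • z) u.2.2 + Sum.elim (v.2.1 • z) v.2.2 := by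
          ext (i | i) <;> simp [add_mul]
        rw [h₁, h₂, mulVec_add]
        abel
      map_smul' := by
        intro c v
        have h₁ : Sum.elim (c • v).1 (B *ᵥ (c • v).1) = c • Sum.elim v.1 (B *ᵥ v.1) := by
          ext (i | i) <;> simp [mulVec_smul]
        have h₂ : Sum.elim ((c • v).2.1 • z) (c • v).2.2 = c • Sum.elim (v.2.1 • z) v.2.2 := by
          ext (i | i) <;> simp [mul_assoc]
        rw [h₁, h₂, mulVec_smul, RingHom.id_apply, smul_sub] }
  have hker : LinearMap.ker f ≠ ⊥ := by
    apply LinearMap.ker_ne_bot_of_finrank_lt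
    simp only [Module.finrank_prod, Module.finrank_fintype_fun_eq_card, Fintype.card_fin,
      Fintype.card_sum, Module.finrank_self]
    omega
  obtain ⟨⟨x, t, y⟩, hv, hv0⟩ := Submodule.exists_mem_ne_zero_of_ne_bot hker
  have hxy : Sum.elim x (B *ᵥ x) = M *ᵥ Sum.elim (t • z) y := sub_eq_zero.mp hv
  have hform : x ⬝ᵥ H *ᵥ x + 2 * (B *ᵥ x ⬝ᵥ A *ᵥ x) = t * t * (z ⬝ᵥ H' *ᵥ z) := by
    have h := dotProduct_fromBlocks_mulVec H' A' (t • z) y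
    rw [← hcong, ← mulVec_mulVec, ← mulVec_mulVec, dotProduct_mulVec, vecMul_transpose, ← hxy,
      dotProduct_fromBlocks_mulVec] at h
    rw [h]
    simp only [mulVec_smul, hz, smul_zero, dotProduct_zero, mul_zero, add_zero,
      smul_dotProduct, dotProduct_smul, smul_eq_mul]
    ring
  have hx : x = 0 := by
    by_contra hx
    have := hB x hx
    nlinarith [mul_self_nonneg t]
  have hty : Sum.elim (t • z) y = 0 := by
    apply Matrix.mulVec_injective_of_isUnit hM
    rw [← hxy, hx, mulVec_zero, mulVec_zero]
    ext (i | i) <;> rfl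
  have htz : t • z = 0 := funext fun i => congrFun hty (Sum.inl i)
  have hy : y = 0 := funext fun i => congrFun hty (Sum.inr i)
  have ht : t = 0 := (smul_eq_zero.mp htz).resolve_right hz0
  exact hv0 (by rw [hx, ht, hy]; rfl)

/-- (Symmetric transformation step.) If the KKT matrix
`[[H, Aᵀ], [A, 0]]` is transformed by an invertible congruence `M` into the KKT
matrix `[[Ĥ, Âᵀ], [Â, 0]]`, then the reduced Hessian `ZᵀHZ` is positive definite
if and only if the reduced Hessian `ẐᵀĤẐ` is positive definite (where `Z`, `Ẑ`
are nullspace bases of `A`, `Â`, respectively). -/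
theorem statement11 (n m : ℕ) (hmn : m ≤ n)
    (H Hhat : Matrix (Fin n) (Fin n) ℝ) (hH : H.IsSymm) (hHhat : Hhat.IsSymm)
    (A Ahat : Matrix (Fin m) (Fin n) ℝ) (hA : A.rank = m) (hAhat : Ahat.rank = m)
    (M : Matrix (Fin n ⊕ Fin m) (Fin n ⊕ Fin m) ℝ) (hM : IsUnit M)
    (hcong : Mᵀ * Matrix.fromBlocks H Aᵀ A 0 * M = Matrix.fromBlocks Hhat Ahatᵀ Ahat 0)
    (Z : Matrix (Fin n) (Fin (n - m)) ℝ)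
    (hZind : LinearIndependent ℝ (fun j : Fin (n - m) => fun i : Fin n => Z i j))
    (hZspan : Submodule.span ℝ
        (Set.range (fun j : Fin (n - m) => fun i : Fin n => Z i j)) =
      LinearMap.ker A.mulVecLin)
    (Zhat : Matrix (Fin n) (Fin (n - m)) ℝ)
    (hZhatind : LinearIndependent ℝ
      (fun j : Fin (n - m) => fun i : Fin n => Zhat i j))
    (hZhatspan : Submodule.span ℝ
        (Set.range (fun j : Fin (n - m) => fun i : Fin n => Zhat i j)) =
      LinearMap.ker Ahat.mulVecLin) :
    (Zᵀ * H * Z).PosDef ↔ (Zhatᵀ * Hhat * Zhat).PosDef := by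
  rw [posDef_reduced_iff hH A Z hZind hZspan,
    posDef_reduced_iff hHhat Ahat Zhat hZhatind hZhatspan]
  have hdet : IsUnit M.det := (Matrix.isUnit_iff_isUnit_det M).mp hM
  have hdetT : IsUnit Mᵀ.det := by rwa [det_transpose]
  have hinv : M⁻¹ᵀ * fromBlocks Hhat Ahatᵀ Ahat 0 * M⁻¹ = fromBlocks H Aᵀ A 0 := by
    rw [← hcong, transpose_nonsing_inv, Matrix.mul_assoc,
      Matrix.mul_nonsing_inv_cancel_right _ _ hdet, Matrix.nonsing_inv_mul_cancel_left _ _ hdetT]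
  exact ⟨pos_on_ker_of_congr hH hA hM hcong,
    pos_on_ker_of_congr hHhat hAhat (Matrix.isUnit_nonsing_inv_iff.mpr hM) hinv⟩
end
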